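/- Let M ∈ ℂ^{(kn+n)×(kn+n)} be Hermitian, partitioned with blocks corresponding to sizes kn and n. Let A_k ∈ ℝ^{kn×kn} be the block upper shift matrix and B_k ∈ ℝ^{kn×n} = [0;…;0;I_n]. Then the following are equivalent: (i) for all θ ∈ ℝ, [z; I_n]ᴴ M [z; I_n] < 0 where z = (e^{iθ}I_{kn} − A_k)^{−1}B_k; (ii) there exists a Hermitian P ∈ ℂ^{kn×kn} such that [[A_kᵀPA_k − P, A_kᵀPB_k],[B_kᵀPA_k, B_kᵀPB_k]] + M < 0. -/

import Mathlib

open Matrix Complex ComplexOrder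

/-- The block upper shift matrix A_k. -/
def blockShift (k n : ℕ) : Matrix (Fin k × Fin n) (Fin k × Fin n) ℂ :=
  Matrix.of fun r c => if (c.1 : ℕ) = (r.1 : ℕ) + 1 ∧ c.2 = r.2 then 1 else 0

/-- The block column B_k with I_n in the bottom block. -/
def blockBottom (k n : ℕ) : Matrix (Fin k × Fin n) (Fin n) ℂ :=
  Matrix.of fun r c => if (r.1 : ℕ) = k - 1 ∧ r.2 = c then 1 else 0

/-- z(θ) = (e^{iθ} I_{kn} − A_k)⁻¹ B_k. -/
noncomputable def zres (k n : ℕ) (θ : ℝ) : Matrix (Fin k × Fin n) (Fin n) ℂ :=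
  (Complex.exp ((θ : ℂ) * Complex.I) • (1 : Matrix (Fin k × Fin n) (Fin k × Fin n) ℂ)
      - blockShift k n)⁻¹ * blockBottom k n

open scoped Matrix.Norms.L2Operator in
theorem exists_spectral_resolution_of_unitary {m : Type*} [Fintype m] [DecidableEq m]
    (U : Matrix m m ℂ) (hU : Uᴴ * U = 1) :
    ∃ (s : Finset ℂ) (E : ℂ → Matrix m m ℂ), (∀ c ∈ s, ‖c‖ = 1) ∧
      (∀ c ∈ s, (E c)ᴴ = E c ∧ E c * E c = E c ∧ U * E c = c • E c) ∧ ∑ c ∈ s, E c = 1 := by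
  classical
  have hmem : U ∈ unitary (Matrix m m ℂ) := ⟨hU, mul_eq_one_comm.mp hU⟩
  have hN : IsStarNormal U := ⟨by
    rw [Commute, SemiconjBy, star_eq_conjTranspose, hU, mul_eq_one_comm.mp hU]⟩
  have hfin : (spectrum ℂ U).Finite := Matrix.finite_spectrum U
  have hcont : ∀ f : ℂ → ℂ, ContinuousOn f (spectrum ℂ U) := fun f => hfin.continuousOn f
  refine ⟨hfin.toFinset, fun c => cfc (fun z => if z = c then (1 : ℂ) else 0) U, ?_, ?_, ?_⟩
  · intro c hc
    simpa using spectrum.subset_circle_of_unitary hmem (hfin.mem_toFinset.mp hc)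
  · intro c _
    refine ⟨?_, ?_, ?_⟩
    · rw [← star_eq_conjTranspose, ← cfc_star]
      congr 1; ext z; split_ifs <;> simp
    · rw [← cfc_mul _ _ U (hcont _) (hcont _)]
      congr 1; ext z; split_ifs <;> simp
    · conv_lhs => enter [1]; rw [← cfc_id ℂ U]
      rw [← cfc_mul _ _ U (hcont _) (hcont _), ← cfc_smul _ _ U (hcont _)]
      congr 1; ext z; split_ifs with h <;> simp [h]
  · rw [← cfc_sum _ U _ (fun _ _ => hcont _), ← cfc_one ℂ U]
    refine cfc_congr fun z hz => ?_
    simp [Finset.sum_apply, hfin.mem_toFinset.mpr hz]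

theorem exists_unitary_of_mul_conjTranspose_eq {p m : Type*} [Fintype p] [DecidableEq p]
    [Fintype m] [DecidableEq m] (X Z : Matrix p m ℂ) (h : X * Xᴴ = Z * Zᴴ) :
    ∃ U : Matrix m m ℂ, Uᴴ * U = 1 ∧ Z = X * U := by
  set S := Matrix.toEuclideanLin Xᴴ with hS
  set T := Matrix.toEuclideanLin Zᴴ with hT
  have hnorm : ∀ v, ‖S v‖ = ‖T v‖ := by
    intro v
    have key : ∀ Y : Matrix p m ℂ, inner ℂ (Matrix.toEuclideanLin Yᴴ v) (Matrix.toEuclideanLin Yᴴ v)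
        = star v.ofLp ⬝ᵥ ((Y * Yᴴ) *ᵥ v.ofLp) := by
      intro Y
      rw [EuclideanSpace.inner_eq_star_dotProduct]
      simp [Matrix.toEuclideanLin, star_mulVec, ← mulVec_mulVec, dotProduct_mulVec]
      rw [dotProduct_comm]
      simp [dotProduct_mulVec, vecMul_vecMul]
    have h2 : ‖S v‖ ^ 2 = ‖T v‖ ^ 2 := by
      have := key X
      rw [h, ← key Z, inner_self_eq_norm_sq_to_K, inner_self_eq_norm_sq_to_K] at this
      exact_mod_cast this
    exact (sq_eq_sq₀ (norm_nonneg _) (norm_nonneg _)).mp h2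
  have hker : LinearMap.ker S ≤ LinearMap.ker T := by
    intro v hv
    rw [LinearMap.mem_ker] at hv ⊢
    rw [← norm_eq_zero, ← hnorm, hv, norm_zero]
  let g : LinearMap.range S →ₗ[ℂ] EuclideanSpace ℂ m :=
    (LinearMap.ker S).liftQ T hker ∘ₗ S.quotKerEquivRange.symm.toLinearMap
  have hg : ∀ v, g ⟨S v, v, rfl⟩ = T v := by
    intro v
    have : S.quotKerEquivRange.symm ⟨S v, v, rfl⟩ = (LinearMap.ker S).mkQ v := by
      rw [LinearEquiv.symm_apply_eq]; rfl
    simp [g, this]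
  let L : LinearMap.range S →ₗᵢ[ℂ] EuclideanSpace ℂ m := ⟨g, by
    rintro ⟨_, v, rfl⟩
    rw [hg, ← hnorm]; rfl⟩
  have hL : ∀ v, L.extend (S v) = T v := fun v =>
    (L.extend_apply ⟨S v, v, rfl⟩).trans (hg v)
  set V := Matrix.toEuclideanLin.symm L.extend.toLinearMap with hV
  have hVL : ∀ v, Matrix.toEuclideanLin V v = L.extend v := by simp [hV]
  have hVX : V * Xᴴ = Zᴴ := by
    apply Matrix.toEuclideanLin.injective
    ext1 v
    have := hL v
    rw [← hVL] at this
    rw [hT] at this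
    rw [← this]
    simp [hS, Matrix.toEuclideanLin]
  have hVV : Vᴴ * V = 1 := by
    apply Matrix.toEuclideanLin.injective
    ext1 v
    apply ext_inner_left ℂ
    intro w
    have h1 := L.extend.inner_map_map w v
    rw [← hVL, ← hVL] at h1
    simp only [EuclideanSpace.inner_eq_star_dotProduct] at h1 ⊢
    simp [Matrix.toEuclideanLin, star_mulVec] at h1 ⊢
    rw [← h1, dotProduct_comm (V *ᵥ v.ofLp), ← dotProduct_mulVec, mulVec_mulVec, dotProduct_comm]
  refine ⟨Vᴴ, by simpa using mul_eq_one_comm.mp hVV, ?_⟩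
  have := congrArg conjTranspose hVX
  simpa using this.symm

theorem trace_conjTranspose_mul_mul_eq_sum {m r : Type*} [Fintype m] [Fintype r]
    (N : Matrix m m ℂ) (G : Matrix m r ℂ) :
    (Gᴴ * N * G).trace = ∑ j, star (G.col j) ⬝ᵥ (N *ᵥ G.col j) := by
  rw [Matrix.mul_assoc]
  rfl

/-- A nonzero positive semidefinite `W` with `C W Cᴴ = J W Jᴴ` is a sum of rank-one terms `v vᴴ`
with `C v = c J v` and `‖c‖ = 1`; hence it pairs negatively with `M` when `M` is negative on all
such `v`. -/
theorem re_trace_mul_neg_of_intertwined {p m : Type*} [Fintype p] [DecidableEq p] [Fintype m]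
    (C J : Matrix p m ℂ) (M : Matrix m m ℂ)
    (hfreq : ∀ c : ℂ, ‖c‖ = 1 → ∀ v : m → ℂ, v ≠ 0 → C *ᵥ v = c • (J *ᵥ v) →
      (star v ⬝ᵥ (M *ᵥ v)).re < 0)
    (W : Matrix m m ℂ) (hW : W.PosSemidef) (hW0 : W ≠ 0) (hCJ : C * W * Cᴴ = J * W * Jᴴ) :
    (W * M).trace.re < 0 := by
  obtain ⟨r, v, hv⟩ := Matrix.posSemidef_iff_eq_sum_vecMulVec.mp hW
  obtain ⟨F, rfl⟩ : ∃ F : Matrix m (Fin r) ℂ, W = F * Fᴴ := by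
    refine ⟨Matrix.of fun a i => v i a, ?_⟩
    rw [hv]
    ext a b
    simp [Matrix.sum_apply, Matrix.mul_apply, vecMulVec_apply]
  obtain ⟨U, hU, hCU⟩ := exists_unitary_of_mul_conjTranspose_eq (J * F) (C * F) (by
    simpa [Matrix.mul_assoc] using hCJ.symm)
  obtain ⟨s, E, hs, hE, hsum⟩ := exists_spectral_resolution_of_unitary U hU
  have hcol : ∀ c ∈ s, ∀ j, (F * E c).col j ≠ 0 →
      (star ((F * E c).col j) ⬝ᵥ (M *ᵥ (F * E c).col j)).re < 0 := by
    intro c hc j hj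
    refine hfreq c (hs c hc) _ hj ?_
    have h1 : C * (F * E c) = c • (J * (F * E c)) := by
      rw [← Matrix.mul_assoc, hCU, Matrix.mul_assoc, (hE c hc).2.2]
      simp [Matrix.mul_assoc]
    ext i
    exact congrFun (congrFun h1 i) j
  have hcol' : ∀ c ∈ s, ∀ j, (star ((F * E c).col j) ⬝ᵥ (M *ᵥ (F * E c).col j)).re ≤ 0 := by
    intro c hc j
    by_cases hj : (F * E c).col j = 0
    · simp [hj]
    · exact (hcol c hc j hj).le
  have htr : (F * Fᴴ * M).trace =
      ∑ c ∈ s, ∑ j, star ((F * E c).col j) ⬝ᵥ (M *ᵥ (F * E c).col j) := by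
    calc (F * Fᴴ * M).trace = (Fᴴ * M * F * ∑ c ∈ s, E c).trace := by
          rw [hsum, Matrix.mul_one, Matrix.mul_assoc, Matrix.trace_mul_comm]
      _ = ∑ c ∈ s, (Fᴴ * M * F * E c).trace := by rw [Matrix.mul_sum, Matrix.trace_sum]
      _ = ∑ c ∈ s, ((F * E c)ᴴ * M * (F * E c)).trace := by
          refine Finset.sum_congr rfl fun c hc => ?_
          obtain ⟨h1, h2, -⟩ := hE c hc
          conv_lhs => rw [← h2, ← Matrix.mul_assoc, Matrix.trace_mul_comm]
          rw [conjTranspose_mul, h1]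
          simp only [Matrix.mul_assoc]
      _ = _ := Finset.sum_congr rfl fun c _ => trace_conjTranspose_mul_mul_eq_sum _ _
  have hne : ∃ c ∈ s, ∃ j, (F * E c).col j ≠ 0 := by
    by_contra! hcon
    have hF : F = 0 := by
      rw [← Matrix.mul_one F, ← hsum, Matrix.mul_sum]
      refine Finset.sum_eq_zero fun c hc => ?_
      ext i j
      exact congrFun (hcon c hc j) i
    exact hW0 (by simp [hF])
  obtain ⟨c, hc, j, hj⟩ := hne
  rw [htr, Complex.re_sum]
  refine Finset.sum_neg' (fun c hc => ?_) ⟨c, hc, ?_⟩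
  · rw [Complex.re_sum]
    exact Finset.sum_nonpos fun j _ => hcol' c hc j
  · rw [Complex.re_sum]
    exact Finset.sum_neg' (fun j _ => hcol' c hc j) ⟨j, Finset.mem_univ _, hcol c hc j hj⟩

theorem isOpen_setOf_re_quadraticForm_neg {m : Type*} [Fintype m] :
    IsOpen {X : Matrix m m ℂ | ∀ v : m → ℂ, v ≠ 0 → (star v ⬝ᵥ (X *ᵥ v)).re < 0} := by
  rw [isOpen_iff_eventually]
  intro X hX
  have hcont : Continuous fun z : Matrix m m ℂ × (m → ℂ) => (star z.2 ⬝ᵥ (z.1 *ᵥ z.2)).re := by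
    fun_prop
  have h := (isCompact_sphere (0 : m → ℂ) 1).eventually_forall_of_forall_eventually
    (x₀ := X) (P := fun X v => (star v ⬝ᵥ (X *ᵥ v)).re < 0) (fun v hv =>
      hcont.continuousAt.eventually (gt_mem_nhds (hX v (by rintro rfl; simp at hv))))
  filter_upwards [h] with Y hY v hv
  have hv' : 0 < ‖v‖ := norm_pos_iff.mpr hv
  have h1 := hY ((‖v‖⁻¹ : ℂ) • v) (by simp [norm_smul, hv'.ne'])
  have h2 : (star ((‖v‖⁻¹ : ℂ) • v) ⬝ᵥ (Y *ᵥ ((‖v‖⁻¹ : ℂ) • v))).re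
      = (‖v‖⁻¹ * ‖v‖⁻¹) * (star v ⬝ᵥ (Y *ᵥ v)).re := by
    simp only [star_smul, mulVec_smul, smul_dotProduct, dotProduct_smul, smul_eq_mul, ← mul_assoc]
    rw [← Complex.re_ofReal_mul]
    simp
  rw [h2] at h1
  exact (pos_iff_neg_of_mul_neg h1).mp (by positivity)

theorem exists_trace_representation {m : Type*} [Fintype m] [DecidableEq m]
    (f : Matrix m m ℂ →ₗ[ℝ] ℝ) :
    ∃ W : Matrix m m ℂ, W.IsHermitian ∧ ∀ X : Matrix m m ℂ, X.IsHermitian → f X = (W * X).trace.re := by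
  let g : Matrix m m ℂ →ₗ[ℂ] ℂ := Module.Dual.extendRCLike (𝕜 := ℂ) f
  have hg : ∀ X, (g X).re = f X := fun X => Module.Dual.re_extendRCLike_apply (𝕜 := ℂ) f X
  let G : Matrix m m ℂ := Matrix.of fun i j => g (single j i 1)
  have hG : ∀ X, g X = (G * X).trace := by
    intro X
    conv_lhs => rw [matrix_eq_sum_single X]
    simp only [map_sum, Matrix.trace, Matrix.diag, Matrix.mul_apply]
    rw [Finset.sum_comm]
    refine Finset.sum_congr rfl fun i _ => Finset.sum_congr rfl fun j _ => ?_
    rw [show single j i (X j i) = X j i • single j i (1 : ℂ) by simp, map_smul, smul_eq_mul,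
      mul_comm]
    rfl
  refine ⟨(2⁻¹ : ℝ) • (G + Gᴴ), ?_, ?_⟩
  · simp [IsHermitian, add_comm]
  · intro X hX
    have h1 : (Gᴴ * X).trace.re = (G * X).trace.re := by
      rw [← hX.eq, ← conjTranspose_mul, trace_conjTranspose, Matrix.trace_mul_comm, hX.eq]
      simp
    rw [← hg, hG]
    simp only [smul_mul_assoc, trace_smul, add_mul, trace_add, Complex.smul_re, Complex.add_re, h1,
      smul_eq_mul]
    ring

/-- Separation of the negative definite cone from an affine family of Hermitian matrices. -/
theorem exists_dual_certificate {p m : Type*} [Fintype p] [Fintype m] [DecidableEq m]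
    (C J : Matrix p m ℂ) (M : Matrix m m ℂ) (hM : M.IsHermitian)
    (h : ¬ ∃ P : Matrix p p ℂ, P.IsHermitian ∧ (-(Cᴴ * P * C - Jᴴ * P * J + M)).PosDef) :
    ∃ W : Matrix m m ℂ, W.PosSemidef ∧ W ≠ 0 ∧ C * W * Cᴴ = J * W * Jᴴ ∧
      0 ≤ (W * M).trace.re := by
  let O : Set (Matrix m m ℂ) := {X | ∀ v : m → ℂ, v ≠ 0 → (star v ⬝ᵥ (X *ᵥ v)).re < 0}
  let L : Matrix p p ℂ → Matrix m m ℂ := fun P => Cᴴ * P * C - Jᴴ * P * J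
  let T : Set (Matrix m m ℂ) := {X | ∃ P : Matrix p p ℂ, P.IsHermitian ∧ X = L P + M}
  have hLh : ∀ P : Matrix p p ℂ, P.IsHermitian → (L P).IsHermitian := fun P hP =>
    (isHermitian_conjTranspose_mul_mul C hP).sub (isHermitian_conjTranspose_mul_mul J hP)
  have hOconv : Convex ℝ O := by
    intro X hX Y hY a b ha hb hab v hv
    have e : (star v ⬝ᵥ ((a • X + b • Y) *ᵥ v)).re =
        a * (star v ⬝ᵥ (X *ᵥ v)).re + b * (star v ⬝ᵥ (Y *ᵥ v)).re := by
      simp [add_mulVec, smul_mulVec, dotProduct_add, dotProduct_smul]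
    rw [e]
    have h1 := hX v hv
    have h2 := hY v hv
    rcases ha.eq_or_lt with rfl | ha
    · obtain rfl : b = 1 := by linarith
      linarith
    · nlinarith
  have hTconv : Convex ℝ T := by
    rintro _ ⟨P, hP, rfl⟩ _ ⟨Q, hQ, rfl⟩ a b ha hb hab
    refine ⟨a • P + b • Q, ?_, ?_⟩
    · simp [IsHermitian, hP.eq, hQ.eq]
    · simp only [L, Matrix.mul_add, Matrix.add_mul, Matrix.mul_smul, Matrix.smul_mul]
      nth_rewrite 3 [← one_smul ℝ M]
      rw [← hab]
      module
  have hdisj : Disjoint O T := by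
    rw [Set.disjoint_left]
    rintro _ hX ⟨P, hP, rfl⟩
    refine h ⟨P, hP, ?_⟩
    have hH : (-(L P + M)).IsHermitian := ((hLh P hP).add hM).neg
    refine PosDef.of_dotProduct_mulVec_pos hH fun v hv => ?_
    rw [Complex.pos_iff]
    refine ⟨?_, ?_⟩
    · rw [neg_mulVec, dotProduct_neg, Complex.neg_re]
      exact neg_pos.mpr (hX v hv)
    · exact (hH.im_star_dotProduct_mulVec_self v).symm
  obtain ⟨f, u, hfO, hfT⟩ := geometric_hahn_banach_open hOconv
    isOpen_setOf_re_quadraticForm_neg hTconv hdisj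
  obtain ⟨W, hWh, hfW⟩ := exists_trace_representation f.toLinearMap
  replace hfW : ∀ X : Matrix m m ℂ, X.IsHermitian → f X = (W * X).trace.re := hfW
  have hsq : ∀ v : m → ℂ, v ≠ 0 → 0 < (star v ⬝ᵥ v).re := fun v hv =>
    (Complex.pos_iff.mp (dotProduct_star_self_pos_iff.mpr hv)).1
  have hnegdef : ∀ R : Matrix m m ℂ, R.PosSemidef → ∀ t : ℝ, 0 < t → -R - t • 1 ∈ O := by
    intro R hR t ht v hv
    have h1 := mul_pos ht (hsq v hv)
    have h2 := (Complex.nonneg_iff.mp (hR.dotProduct_mulVec_nonneg v)).1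
    have e : (star v ⬝ᵥ ((-R - t • 1) *ᵥ v)).re =
        -(star v ⬝ᵥ (R *ᵥ v)).re - t * (star v ⬝ᵥ v).re := by
      simp [sub_mulVec, neg_mulVec, smul_mulVec, dotProduct_sub, dotProduct_smul]
    rw [e]
    linarith
  have hf1 : ∀ t : ℝ, 0 < t → -(t * f 1) < u := by
    intro t ht
    simpa using hfO _ (hnegdef 0 PosSemidef.zero t ht)
  have hu : 0 ≤ u := by
    by_contra! hu
    have h1 := hf1 1 one_pos
    have hpos : 0 < f 1 := by linarith
    have h2 := hf1 (-u / (2 * f 1)) (div_pos (by linarith) (by linarith))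
    have h3 : -u / (2 * f 1) * f 1 = -u / 2 := by field_simp
    linarith
  have hTs : ∀ P : Matrix p p ℂ, P.IsHermitian → ∀ t : ℝ, u ≤ t * f (L P) + f M := by
    intro P hP t
    have := hfT (L (t • P) + M) ⟨t • P, by simp [IsHermitian, hP.eq], rfl⟩
    rw [map_add, show L (t • P) = t • L P by simp [L, smul_sub], map_smul, smul_eq_mul] at this
    exact this
  have hfM : u ≤ f M := by simpa using hTs 0 isHermitian_zero 0
  have hfL : ∀ P : Matrix p p ℂ, P.IsHermitian → f (L P) = 0 := by
    intro P hP
    by_contra hne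
    have := hTs P hP ((u - f M - 1) / f (L P))
    rw [div_mul_cancel₀ _ hne] at this
    linarith
  refine ⟨W, ?_, ?_, ?_, ?_⟩
  · refine PosSemidef.of_dotProduct_mulVec_nonneg hWh fun v => ?_
    rw [Complex.nonneg_iff]
    refine ⟨?_, (hWh.im_star_dotProduct_mulVec_self v).symm⟩
    have hR := posSemidef_vecMulVec_self_star v
    have hfR : f (vecMulVec v (star v)) = (star v ⬝ᵥ (W *ᵥ v)).re := by
      rw [hfW _ hR.isHermitian, mul_vecMulVec, trace_vecMulVec, dotProduct_comm]
    change 0 ≤ (star v ⬝ᵥ (W *ᵥ v)).re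
    rw [← hfR]
    by_contra! hneg
    have h1 := hf1 1 one_pos
    have hs : 0 < (u + f 1) / -f (vecMulVec v (star v)) :=
      div_pos (by linarith) (by linarith)
    have h2 := hfO _ (hnegdef _ (hR.smul hs.le) 1 one_pos)
    simp only [map_sub, map_neg, map_smul, smul_eq_mul] at h2
    have h3 : (u + f 1) / -f (vecMulVec v (star v)) * f (vecMulVec v (star v)) = -(u + f 1) := by
      have hne := hneg.ne
      field_simp
    linarith
  · rintro rfl
    have h1 := hf1 1 one_pos
    have h2 := hfW 1 isHermitian_one
    have h3 := hfW M hM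
    simp only [Matrix.zero_mul, trace_zero, Complex.zero_re] at h2 h3
    linarith
  · set D := C * W * Cᴴ - J * W * Jᴴ with hD
    have hDh : D.IsHermitian :=
      (isHermitian_mul_mul_conjTranspose C hWh).sub (isHermitian_mul_mul_conjTranspose J hWh)
    have h1 := hfL D hDh
    rw [hfW _ (hLh D hDh)] at h1
    have h2 : (W * L D).trace = (Dᴴ * D).trace := by
      rw [hDh.eq]
      nth_rewrite 2 [hD]
      simp only [L, Matrix.mul_sub, Matrix.sub_mul, trace_sub]
      congr 1
      · rw [← Matrix.mul_assoc, Matrix.trace_mul_comm]; simp only [Matrix.mul_assoc]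
      · rw [← Matrix.mul_assoc, Matrix.trace_mul_comm]; simp only [Matrix.mul_assoc]
    have h3 : (Dᴴ * D).trace = 0 := by
      have := (posSemidef_conjTranspose_mul_self D).trace_nonneg
      rw [Complex.nonneg_iff] at this
      rw [h2] at h1
      exact Complex.ext h1 this.2.symm
    exact sub_eq_zero.mp (trace_conjTranspose_mul_self_eq_zero_iff.mp h3)
  · rw [← hfW M hM]
    linarith

/-- A strict KYP lemma for a pencil `C - c J` on the unit circle. -/
theorem exists_isHermitian_posDef_iff {p m : Type*} [Fintype p] [DecidableEq p]
    [Fintype m] [DecidableEq m] (C J : Matrix p m ℂ) (M : Matrix m m ℂ) (hM : M.IsHermitian) :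
    (∀ c : ℂ, ‖c‖ = 1 → ∀ v : m → ℂ, v ≠ 0 → C *ᵥ v = c • (J *ᵥ v) →
      (star v ⬝ᵥ (M *ᵥ v)).re < 0) ↔
    ∃ P : Matrix p p ℂ, P.IsHermitian ∧ (-(Cᴴ * P * C - Jᴴ * P * J + M)).PosDef := by
  constructor
  · intro hfreq
    by_contra h
    obtain ⟨W, hW, hW0, hCJ, hnonneg⟩ := exists_dual_certificate C J M hM h
    exact hnonneg.not_gt (re_trace_mul_neg_of_intertwined C J M hfreq W hW hW0 hCJ)
  · rintro ⟨P, -, hP⟩ c hc v hv hCv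
    have h1 := (Complex.pos_iff.mp (hP.dotProduct_mulVec_pos hv)).1
    have hquad : ∀ Y : Matrix p m ℂ, star v ⬝ᵥ ((Yᴴ * P * Y) *ᵥ v) =
        star (Y *ᵥ v) ⬝ᵥ (P *ᵥ (Y *ᵥ v)) := by
      intro Y
      rw [star_mulVec, ← dotProduct_mulVec, mulVec_mulVec, mulVec_mulVec, Matrix.mul_assoc]
    have hcc : star c * c = 1 := by
      rw [Complex.star_def, Complex.conj_mul', hc]; simp
    have h2 : star v ⬝ᵥ ((Cᴴ * P * C) *ᵥ v) = star v ⬝ᵥ ((Jᴴ * P * J) *ᵥ v) := by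
      rw [hquad, hquad, hCv, star_smul, mulVec_smul, smul_dotProduct, dotProduct_smul,
        smul_smul, hcc, one_smul]
    rw [neg_mulVec, dotProduct_neg, add_mulVec, dotProduct_add, sub_mulVec, dotProduct_sub, h2,
      sub_self, zero_add, Complex.neg_re] at h1
    linarith

theorem fromBlocks_lyapunov_eq {p q : Type*} [Fintype p] [DecidableEq p] [Fintype q]
    (A P : Matrix p p ℂ) (B : Matrix p q ℂ) :
    fromBlocks (Aᴴ * P * A - P) (Aᴴ * P * B) (Bᴴ * P * A) (Bᴴ * P * B) =
      (fromCols A B)ᴴ * P * fromCols A B -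
        (fromCols (1 : Matrix p p ℂ) (0 : Matrix p q ℂ))ᴴ * P *
          fromCols (1 : Matrix p p ℂ) (0 : Matrix p q ℂ) := by
  simp only [conjTranspose_fromCols_eq_fromRows_conjTranspose, fromRows_mul]
  ext (i | i) (j | j) <;> simp

theorem fromCols_mulVec_eq_smul_iff {p q : Type*} [Fintype p] [DecidableEq p] [Fintype q]
    [DecidableEq q] (A : Matrix p p ℂ) (B : Matrix p q ℂ) (c : ℂ)
    (hc : IsUnit (c • (1 : Matrix p p ℂ) - A)) (v : p ⊕ q → ℂ) :
    fromCols A B *ᵥ v = c • (fromCols (1 : Matrix p p ℂ) (0 : Matrix p q ℂ) *ᵥ v) ↔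
      ∃ y : q → ℂ, v = fromRows ((c • 1 - A)⁻¹ * B) 1 *ᵥ y := by
  have hdet := (isUnit_iff_isUnit_det _).mp hc
  constructor
  · intro h
    refine ⟨v ∘ Sum.inr, ?_⟩
    have h1 : (c • (1 : Matrix p p ℂ) - A) *ᵥ (v ∘ Sum.inl) = B *ᵥ (v ∘ Sum.inr) := by
      simp only [fromCols_mulVec, one_mulVec, zero_mulVec, add_zero] at h
      rw [sub_mulVec, smul_mulVec, one_mulVec, ← h]
      abel
    rw [fromRows_mulVec, one_mulVec, ← mulVec_mulVec, ← h1, mulVec_mulVec,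
      nonsing_inv_mul _ hdet, one_mulVec, Sum.elim_comp_inl_inr]
  · rintro ⟨y, rfl⟩
    have h1 : (c • (1 : Matrix p p ℂ) - A) *ᵥ (((c • 1 - A)⁻¹ * B) *ᵥ y) = B *ᵥ y := by
      rw [mulVec_mulVec, ← Matrix.mul_assoc, mul_nonsing_inv _ hdet, Matrix.one_mul]
    simp only [fromRows_mulVec, one_mulVec, fromCols_mulVec, zero_mulVec, add_zero,
      Sum.elim_comp_inl, Sum.elim_comp_inr]
    rw [← h1, sub_mulVec, smul_mulVec, one_mulVec]
    abel

/-- The strict discrete-time KYP lemma for `A` without eigenvalues on the unit circle. -/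
theorem exists_isHermitian_posDef_iff_of_isUnit {p q : Type*} [Fintype p] [DecidableEq p]
    [Fintype q] [DecidableEq q] (A : Matrix p p ℂ) (B : Matrix p q ℂ)
    (hA : ∀ c : ℂ, ‖c‖ = 1 → IsUnit (c • (1 : Matrix p p ℂ) - A))
    (M : Matrix (p ⊕ q) (p ⊕ q) ℂ) (hM : M.IsHermitian) :
    (∀ c : ℂ, ‖c‖ = 1 → (-(fromRows ((c • 1 - A)⁻¹ * B) (1 : Matrix q q ℂ))ᴴ * M *
        fromRows ((c • 1 - A)⁻¹ * B) (1 : Matrix q q ℂ)).PosDef) ↔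
      ∃ P : Matrix p p ℂ, P.IsHermitian ∧
        (-(fromBlocks (Aᴴ * P * A - P) (Aᴴ * P * B) (Bᴴ * P * A) (Bᴴ * P * B) + M)).PosDef := by
  simp only [fromBlocks_lyapunov_eq]
  rw [← exists_isHermitian_posDef_iff _ _ M hM]
  refine forall₂_congr fun c hc => ?_
  set Z := fromRows ((c • 1 - A)⁻¹ * B) (1 : Matrix q q ℂ) with hZ
  have hquad : ∀ y : q → ℂ, star y ⬝ᵥ ((-Zᴴ * M * Z) *ᵥ y) =
      -(star (Z *ᵥ y) ⬝ᵥ (M *ᵥ (Z *ᵥ y))) := by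
    intro y
    rw [Matrix.neg_mul, Matrix.neg_mul, neg_mulVec, dotProduct_neg, star_mulVec,
      ← dotProduct_mulVec, mulVec_mulVec, mulVec_mulVec, Matrix.mul_assoc]
  have hZ0 : ∀ y : q → ℂ, Z *ᵥ y = 0 → y = 0 := by
    intro y hy
    rw [hZ, fromRows_mulVec, one_mulVec] at hy
    ext i
    exact congrFun hy (Sum.inr i)
  constructor
  · intro h v hv hCv
    obtain ⟨y, rfl⟩ := (fromCols_mulVec_eq_smul_iff A B c (hA c hc) v).mp hCv
    have hy : y ≠ 0 := by rintro rfl; simp at hv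
    have := (Complex.pos_iff.mp (h.dotProduct_mulVec_pos hy)).1
    rw [hquad, Complex.neg_re] at this
    linarith
  · intro h
    have hH : (-Zᴴ * M * Z).IsHermitian := by
      rw [Matrix.neg_mul, Matrix.neg_mul]
      exact (isHermitian_conjTranspose_mul_mul Z hM).neg
    refine PosDef.of_dotProduct_mulVec_pos hH fun y hy => Complex.pos_iff.mpr
      ⟨?_, (hH.im_star_dotProduct_mulVec_self y).symm⟩
    rw [hquad, Complex.neg_re]
    exact neg_pos.mpr (h _ (fun h0 => hy (hZ0 y h0))
      ((fromCols_mulVec_eq_smul_iff A B c (hA c hc) _).mpr ⟨y, rfl⟩))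

theorem blockShift_pow_apply_eq_zero {k n : ℕ} (j : ℕ) (r c : Fin k × Fin n)
    (h : (c.1 : ℕ) < (r.1 : ℕ) + j) : (blockShift k n ^ j) r c = 0 := by
  induction j generalizing c with
  | zero =>
    rw [pow_zero, one_apply_ne]
    rintro rfl
    omega
  | succ j ih =>
    rw [pow_succ, Matrix.mul_apply]
    refine Finset.sum_eq_zero fun d _ => ?_
    by_cases hd : (d.1 : ℕ) < (r.1 : ℕ) + j
    · rw [ih d hd, zero_mul]
    · rw [blockShift, of_apply, if_neg (by omega), mul_zero]

theorem isNilpotent_blockShift (k n : ℕ) : IsNilpotent (blockShift k n) :=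
  ⟨k, by
    ext r c
    exact blockShift_pow_apply_eq_zero k r c (by omega)⟩

theorem isUnit_smul_one_sub_blockShift {k n : ℕ} {c : ℂ} (hc : c ≠ 0) :
    IsUnit (c • (1 : Matrix (Fin k × Fin n) (Fin k × Fin n) ℂ) - blockShift k n) := by
  rw [sub_eq_add_neg]
  refine (isNilpotent_blockShift k n).neg.isUnit_add_left_of_commute ?_ ?_
  · rw [← Algebra.algebraMap_eq_smul_one]
    exact (IsUnit.mk0 c hc).map _
  · exact (Commute.one_right _).smul_right c

/- STATEMENT 15 (discrete-time KYP lemma for the pair (A_k, B_k)): for Hermitian M,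
(i) for all θ ∈ ℝ, [z; I_n]ᴴ M [z; I_n] < 0 with z = (e^{iθ}I − A_k)⁻¹B_k
is equivalent to
(ii) there is a Hermitian P with
[[A_kᴴPA_k − P, A_kᴴPB_k],[B_kᴴPA_k, B_kᴴPB_k]] + M < 0. -/
theorem stmt15 {k n : ℕ} (hk : 1 ≤ k)
    (M : Matrix ((Fin k × Fin n) ⊕ Fin n) ((Fin k × Fin n) ⊕ Fin n) ℂ)
    (hM : M.IsHermitian) :
    (∀ θ : ℝ,
        (-(Matrix.fromRows (zres k n θ) (1 : Matrix (Fin n) (Fin n) ℂ))ᴴ * M *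
            Matrix.fromRows (zres k n θ) (1 : Matrix (Fin n) (Fin n) ℂ)).PosDef) ↔
      ∃ P : Matrix (Fin k × Fin n) (Fin k × Fin n) ℂ, P.IsHermitian ∧
        (-(Matrix.fromBlocks
            ((blockShift k n)ᴴ * P * blockShift k n - P)
            ((blockShift k n)ᴴ * P * blockBottom k n)
            ((blockBottom k n)ᴴ * P * blockShift k n)
            ((blockBottom k n)ᴴ * P * blockBottom k n) + M)).PosDef := by
  rw [← exists_isHermitian_posDef_iff_of_isUnit (blockShift k n) (blockBottom k n)
    (fun c hc => isUnit_smul_one_sub_blockShift (by rintro rfl; simp at hc)) M hM]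
  constructor
  · intro h c hc
    obtain ⟨θ, rfl⟩ := (Complex.norm_eq_one_iff c).mp hc
    exact h θ
  · intro h θ
    exact h _ (Complex.norm_exp_ofReal_mul_I θ)
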